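/- For every integer n ≥ 3, every reset word for the automaton 𝒲_n has length at least n² − 3n + 3. -/

import Mathlib

/-- The two input letters of the automaton. -/
inductive Letter | a | b

/-- Transition function of the automaton `𝒲ₙ` on states `{1, …, n}`:
`δ(i,a) = δ(i,b) = i+1` for `1 ≤ i ≤ n-1`, `δ(n,a) = 2`, `δ(n,b) = 1`. -/
def delta (n : ℕ) (q : ℕ) : Letter → ℕ
  | Letter.a => if q < n then q + 1 else 2
  | Letter.b => if q < n then q + 1 else 1

/-- `w` is a reset word: it sends every state in `{1, …, n}` to one single state. -/
def IsReset (n : ℕ) (w : List Letter) : Prop :=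
  ∃ p : ℕ, ∀ q ∈ Finset.Icc 1 n, w.foldl (delta n) q = p

/-- Along any run, `q + |w|` exceeds the final state by a sum of lengths of the two cycles. -/
theorem foldl_delta_spec {n : ℕ} (hn : 3 ≤ n) (w : List Letter) {q : ℕ} (h1 : 1 ≤ q)
    (hq : q ≤ n) :
    (1 ≤ w.foldl (delta n) q ∧ w.foldl (delta n) q ≤ n) ∧
      ∃ x y : ℕ, q + w.length = w.foldl (delta n) q + x * n + y * (n - 1) := by
  induction w using List.reverseRecOn with
  | nil => exact ⟨⟨h1, hq⟩, 0, 0, by simp⟩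
  | append_singleton v c ih =>
    obtain ⟨⟨hr1, hrn⟩, x, y, h⟩ := ih
    rw [List.foldl_append, List.length_append]
    simp only [List.foldl_cons, List.foldl_nil, List.length_singleton]
    generalize v.foldl (delta n) q = r at *
    rcases lt_or_eq_of_le hrn with hlt | rfl
    · have hd : delta n r c = r + 1 := by cases c <;> simp [delta, hlt]
      rw [hd]
      exact ⟨by omega, x, y, by omega⟩
    · cases c
      · have hd : delta r r Letter.a = 2 := by simp [delta]
        rw [hd]
        exact ⟨by omega, x, y + 1, by rw [add_one_mul]; omega⟩
      · have hd : delta r r Letter.b = 1 := by simp [delta]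
        rw [hd]
        exact ⟨by omega, x + 1, y, by rw [add_one_mul]; omega⟩

/-- A letter can merge two distinct states only into state `2`. -/
theorem delta_eq_two_of_merge {n r s : ℕ} {c : Letter} (hr : 1 ≤ r ∧ r ≤ n)
    (hs : 1 ≤ s ∧ s ≤ n) (hne : r ≠ s) (h : delta n r c = delta n s c) : delta n r c = 2 := by
  cases c <;> simp only [delta] at h ⊢ <;> split_ifs at h ⊢ <;> omega

/-- If all states reach state `2` along a word of length `L`, then the Frobenius number of
`n - 1` and `n` is less than `L - 1`. -/
theorem length_ge_of_reset_to_two {n : ℕ} (hn : 3 ≤ n) (L : ℕ)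
    (h : ∀ q, 1 ≤ q → q ≤ n → ∃ x y : ℕ, q + L = 2 + x * n + y * (n - 1)) :
    n ^ 2 - 3 * n + 3 ≤ L := by
  obtain ⟨m, rfl⟩ : ∃ m, n = m + 1 := ⟨n - 1, by omega⟩
  simp only [Nat.add_sub_cancel] at h
  have hexp : (m + 1) ^ 2 - 3 * (m + 1) + 3 + m = m * m + 1 := by
    have : 2 * m ≤ m * m := Nat.mul_le_mul_right m (by omega)
    have : (m + 1) ^ 2 = m * m + 2 * m + 1 := by ring
    omega
  by_contra hlt
  obtain ⟨d, hd⟩ : ∃ d, L + m + d = m * m := ⟨m * m - (L + m), by omega⟩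
  obtain ⟨x, y, hxy⟩ := h (d % (m + 1) + 1) (by omega) (Nat.mod_lt _ (by omega))
  have hdiv := Nat.div_add_mod d (m + 1)
  have hcop : Nat.Coprime (m + 1) m := by simp
  refine hcop.mul_add_mul_ne_mul (Nat.succ_ne_zero (x + d / (m + 1)))
    (Nat.succ_ne_zero y) ?_
  simp only [Nat.succ_eq_add_one]
  nlinarith

/-- Every reset word for `𝒲ₙ` has length at least `n² - 3n + 3`. -/
theorem wielandt_automaton_lower_bound (n : ℕ) (hn : 3 ≤ n)
    (w : List Letter) (hw : IsReset n w) :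
    n ^ 2 - 3 * n + 3 ≤ w.length := by
  induction w using List.reverseRecOn with
  | nil =>
    obtain ⟨p, hp⟩ := hw
    have h1 := hp 1 (Finset.mem_Icc.2 ⟨le_rfl, by omega⟩)
    have h2 := hp 2 (Finset.mem_Icc.2 ⟨by omega, by omega⟩)
    simp only [List.foldl_nil] at h1 h2
    omega
  | append_singleton v c ih =>
    by_cases hv : IsReset n v
    · exact (ih hv).trans (by simp)
    obtain ⟨p, hp⟩ := hw
    have hp2 : p = 2 := by
      by_contra hne
      refine hv ⟨v.foldl (delta n) 1, fun q hq => ?_⟩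
      have hq' := Finset.mem_Icc.1 hq
      have e1 := hp 1 (Finset.mem_Icc.2 ⟨le_rfl, by omega⟩)
      have eq := hp q hq
      simp only [List.foldl_append, List.foldl_cons, List.foldl_nil] at e1 eq
      by_contra hrs
      exact hne (eq ▸ delta_eq_two_of_merge (foldl_delta_spec hn v hq'.1 hq'.2).1
        (foldl_delta_spec hn v le_rfl (by omega)).1 hrs (eq.trans e1.symm))
    refine length_ge_of_reset_to_two hn _ fun q h1 hq => ?_
    obtain ⟨-, x, y, h⟩ := foldl_delta_spec hn (v ++ [c]) h1 hq
    rw [hp q (Finset.mem_Icc.2 ⟨h1, hq⟩), hp2] at h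
    exact ⟨x, y, h⟩
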